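/- arXiv:1812.06897 — 10 statements merged into one kernel-verified Lean document; each statement's English description precedes it below -/
import Mathlib

section
/- Hartmann–Tzeng bound: Suppose there exist u, z1, z2 ∈ ZMod n and integers δ ≥ 2, γ ≥ 0 such that z1 and z2 are units of ZMod n (i.e., gcd(z1, n) = gcd(z2, n) = 1) and u + s1·z1 + s2·z2 ∈ D for all integers 0 ≤ s1 ≤ δ − 2 and 0 ≤ s2 ≤ γ. Then every nonzero codeword of C(D) has Hamming weight at least δ + γ. -/
/-- The cyclic code with defining set `D`: all `c : ZMod n → F` such that for every
`m ∈ D`, `∑ x, c x * α ^ (m.val * x.val) = 0`. -/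
def cyclicCode (F : Type*) [Field F] (n : ℕ) [NeZero n] (α : F) (D : Set (ZMod n)) :
    Submodule F (ZMod n → F) where
  carrier := {c | ∀ m ∈ D, ∑ x : ZMod n, c x * α ^ (m.val * x.val) = 0}
  add_mem' := by
    intro a b ha hb m hm
    simp only [Set.mem_setOf_eq] at *
    simp only [Pi.add_apply, add_mul, Finset.sum_add_distrib, ha m hm, hb m hm, add_zero]
  zero_mem' := by
    intro m hm
    simp
  smul_mem' := by
    intro r a ha m hm
    simp only [Set.mem_setOf_eq] at *
    simp only [Pi.smul_apply, smul_eq_mul, mul_assoc, ← Finset.mul_sum, ha m hm, mul_zero]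

open Polynomial in
theorem ht_aux {ι F : Type*} [DecidableEq ι] [Field F] (S : Finset ι) (a X Y : ι → F)
    (hX : Function.Injective X) (hY : Function.Injective Y) (d g : ℕ)
    (hcard : S.card ≤ d + g + 1) (i0 : ι) (hi0 : i0 ∈ S)
    (h : ∀ s t : ℕ, s ≤ d → t ≤ g → ∑ i ∈ S, a i * X i ^ s * Y i ^ t = 0) : a i0 = 0 := by
  have key : ∀ P Q : F[X], P.natDegree < d + 1 → Q.natDegree < g + 1 →
      ∑ i ∈ S, a i * P.eval (X i) * Q.eval (Y i) = 0 := by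
    intro P Q hP hQ
    have : ∀ i ∈ S, a i * P.eval (X i) * Q.eval (Y i) =
        ∑ s ∈ Finset.range (d+1), ∑ t ∈ Finset.range (g+1),
          P.coeff s * Q.coeff t * (a i * X i ^ s * Y i ^ t) := by
      intro i _
      rw [eval_eq_sum_range' hP, eval_eq_sum_range' hQ, mul_assoc, Finset.sum_mul_sum,
        Finset.mul_sum]
      refine Finset.sum_congr rfl fun s _ => ?_
      rw [Finset.mul_sum]
      exact Finset.sum_congr rfl fun t _ => by ring
    rw [Finset.sum_congr rfl this, Finset.sum_comm]
    refine Finset.sum_eq_zero fun s hs => ?_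
    rw [Finset.sum_comm]
    refine Finset.sum_eq_zero fun t ht => ?_
    rw [← Finset.mul_sum, h s t (by simpa [Nat.lt_succ_iff] using hs)
      (by simpa [Nat.lt_succ_iff] using ht), mul_zero]
  have hc1 : (S.erase i0).card ≤ d + g := by
    rw [Finset.card_erase_of_mem hi0]; omega
  obtain ⟨A, hA, hAc⟩ := Finset.exists_subset_card_eq
    (s := S.erase i0) (n := min d (S.erase i0).card) (min_le_right _ _)
  have hB : ((S.erase i0) \ A).card ≤ g := by
    rw [Finset.card_sdiff_of_subset hA]; omega
  have hk := key (∏ j ∈ A, (Polynomial.X - C (X j)))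
    (∏ j ∈ (S.erase i0) \ A, (Polynomial.X - C (Y j)))
    (by rw [natDegree_finsetProd_X_sub_C_eq_card]; omega)
    (by rw [natDegree_finsetProd_X_sub_C_eq_card]; omega)
  rw [Finset.sum_eq_single_of_mem i0 hi0] at hk
  · simp only [eval_prod, eval_sub, eval_X, eval_C, mul_eq_zero, Finset.prod_eq_zero_iff,
      sub_eq_zero] at hk
    rcases hk with (hk | ⟨j, hj, hk⟩) | ⟨j, hj, hk⟩
    · exact hk
    · have := hX hk
      subst this
      simpa using hA hj
    · have := hY hk
      subst this
      simp at hj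
  · intro j hj hne
    simp only [eval_prod, eval_sub, eval_X, eval_C, mul_eq_zero, Finset.prod_eq_zero_iff,
      sub_eq_zero]
    by_cases hjA : j ∈ A
    · exact Or.inl (Or.inr ⟨j, hjA, rfl⟩)
    · exact Or.inr ⟨j, by simp [hj, hne, hjA], rfl⟩

theorem ht_pow_eq {F : Type*} [Field F] {n : ℕ} [NeZero n] {α : F}
    (hα : IsPrimitiveRoot α n) (a b : ℕ) : α ^ a = α ^ b ↔ (a : ZMod n) = (b : ZMod n) := by
  have hn : 0 < n := Nat.pos_of_ne_zero (NeZero.ne n)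
  rw [ZMod.natCast_eq_natCast_iff, ← pow_mod_orderOf α a, ← pow_mod_orderOf α b,
    ← hα.eq_orderOf]
  exact ⟨fun h => hα.pow_inj (Nat.mod_lt _ hn) (Nat.mod_lt _ hn) h, fun h => by rw [h]⟩

theorem ht_inj {F : Type*} [Field F] {n : ℕ} [NeZero n] {α : F}
    (hα : IsPrimitiveRoot α n) (z : ZMod n) (hz : IsUnit z) :
    Function.Injective (fun x : ZMod n => α ^ (z.val * x.val)) := by
  intro x y h
  have := (ht_pow_eq hα _ _).1 h
  simp only [Nat.cast_mul, ZMod.natCast_val, ZMod.cast_id', id] at this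
  exact hz.mul_left_cancel this

/-- Hartmann–Tzeng bound: if `u + s₁·z₁ + s₂·z₂ ∈ D` for all `0 ≤ s₁ ≤ δ - 2` and
`0 ≤ s₂ ≤ γ`, with `z₁, z₂` units of `ZMod n`, then every nonzero codeword of the
cyclic code with defining set `D` has Hamming weight at least `δ + γ`. -/
theorem hartmann_tzeng_bound (F : Type*) [Field F] (n : ℕ) [NeZero n] (α : F)
    (hα : IsPrimitiveRoot α n) (D : Set (ZMod n))
    (u z1 z2 : ZMod n) (δ γ : ℕ) (hδ : 2 ≤ δ)
    (hz1 : IsUnit z1) (hz2 : IsUnit z2)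
    (hD : ∀ s1 s2 : ℕ, s1 ≤ δ - 2 → s2 ≤ γ →
      u + (s1 : ZMod n) * z1 + (s2 : ZMod n) * z2 ∈ D)
    (c : ZMod n → F) (hc : c ∈ cyclicCode F n α D) (hc0 : c ≠ 0) :
    δ + γ ≤ Set.ncard {x : ZMod n | c x ≠ 0} := by
  classical
  have hn : n ≠ 0 := NeZero.ne n
  by_contra hlt
  apply hc0
  funext i0
  by_contra hi0
  change c i0 ≠ 0 at hi0
  have hset : {x : ZMod n | c x ≠ 0} = ((Finset.univ.filter fun x => c x ≠ 0 : Finset (ZMod n)) :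
      Set (ZMod n)) := by ext; simp
  rw [hset, Set.ncard_coe_finset] at hlt
  have h := ht_aux (Finset.univ.filter fun x => c x ≠ 0) (fun x => c x * α ^ (u.val * x.val))
    _ _ (ht_inj hα z1 hz1) (ht_inj hα z2 hz2) (δ - 2) γ (by omega) i0 (by simp [hi0]) ?_
  · rcases mul_eq_zero.1 h with h | h
    · exact hi0 h
    · exact pow_ne_zero _ (hα.ne_zero hn) h
  · intro s t hs ht
    have h0 := hc _ (hD s t hs ht)
    rw [Finset.sum_filter]
    refine Eq.trans ?_ h0
    refine Finset.sum_congr rfl fun x _ => ?_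
    have hp : α ^ ((u + (s : ZMod n) * z1 + (t : ZMod n) * z2).val * x.val) =
        α ^ (u.val * x.val + z1.val * x.val * s + z2.val * x.val * t) := by
      rw [ht_pow_eq hα]
      simp only [Nat.cast_mul, Nat.cast_add, ZMod.natCast_val, ZMod.cast_id', id]
      ring
    rw [hp, pow_add, pow_add, pow_mul, pow_mul _ _ t]
    by_cases hx : c x = 0
    · simp [hx]
    · simp only [ne_eq, hx, not_false_eq_true, if_true]
      ring
end

section
/- BCH bound: Suppose there exist u, z ∈ ZMod n and an integer δ ≥ 2 such that z is a unit of ZMod n (i.e., gcd(z, n) = 1) and u + s·z ∈ D for all integers 0 ≤ s ≤ δ − 2. Then every nonzero codeword of C(D) has Hamming weight at least δ. -/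
/-- BCH bound: if `u + s·z ∈ D` for all `0 ≤ s ≤ δ - 2`, with `z` a unit of `ZMod n`,
then every nonzero codeword of the cyclic code with defining set `D` has Hamming weight
at least `δ`. -/
theorem bch_bound (F : Type*) [Field F] (n : ℕ) [NeZero n] (α : F)
    (hα : IsPrimitiveRoot α n) (D : Set (ZMod n))
    (u z : ZMod n) (δ : ℕ) (hδ : 2 ≤ δ)
    (hz : IsUnit z)
    (hD : ∀ s : ℕ, s ≤ δ - 2 → u + (s : ZMod n) * z ∈ D)
    (c : ZMod n → F) (hc : c ∈ cyclicCode F n α D) (hc0 : c ≠ 0) :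
    δ ≤ Set.ncard {x : ZMod n | c x ≠ 0} := by
  classical
  have key : ∀ a b : ℕ, α ^ a = α ^ b ↔ (a : ZMod n) = (b : ZMod n) := by
    intro a b
    have hf : IsOfFinOrder α := isOfFinOrder_iff_pow_eq_one.2 ⟨n, NeZero.pos n, hα.pow_eq_one⟩
    rw [ZMod.natCast_eq_natCast_iff, hf.pow_eq_pow_iff_modEq, ← hα.eq_orderOf]
  by_contra hlt
  push Not at hlt
  set S : Finset (ZMod n) := Finset.univ.filter (fun x => c x ≠ 0) with hS
  have hcard : Set.ncard {x : ZMod n | c x ≠ 0} = S.card := by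
    rw [← Set.ncard_coe_finset]
    congr 1
    ext x
    simp [hS]
  rw [hcard] at hlt
  let e : Fin S.card ≃ S := S.equivFin.symm
  have hα0 : α ≠ 0 := hα.ne_zero (NeZero.ne n)
  have hv := Matrix.eq_zero_of_forall_pow_sum_mul_pow_eq_zero
    (f := fun j : Fin S.card => α ^ (z.val * (e j : ZMod n).val))
    (v := fun j : Fin S.card => c (e j) * α ^ (u.val * (e j : ZMod n).val)) ?_ ?_
  · apply hc0
    funext x
    by_contra hx
    have hxS : x ∈ S := by simpa [hS] using hx
    have h := congrFun hv (e.symm ⟨x, hxS⟩)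
    simp only [Equiv.apply_symm_apply, Pi.zero_apply] at h
    exact (mul_ne_zero hx (pow_ne_zero _ hα0)) h
  · intro i j hij
    have h := (key _ _).1 hij
    push_cast at h
    simp only [ZMod.natCast_val, ZMod.cast_id', id] at h
    exact e.injective (Subtype.ext (hz.mul_left_cancel h))
  · intro i
    have h := hc _ (hD i (by have := i.2; omega))
    rw [← h]
    rw [← Finset.sum_subset (Finset.subset_univ S)
      (by intro x _ hx; have : c x = 0 := by simpa [hS] using hx
          simp [this])]
    rw [← Finset.sum_coe_sort S, ← Equiv.sum_comp e]
    refine Finset.sum_congr rfl fun j _ => ?_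
    rw [mul_assoc, ← pow_mul, ← pow_add]
    congr 1
    rw [key]
    push_cast
    simp only [ZMod.natCast_val, ZMod.cast_id', id]
    ring
end

section
/- Locality of the construction: Fix a direction i ∈ {1, …, t} and let C = C(D_i) be the cyclic code with defining set D_i. Then C has (n_i − ρ_i + 1, ρ_i)-locality with respect to the partition {A_{i,j} : 0 ≤ j < n/n_i}: for every codeword c ∈ C and every 0 ≤ j < n/n_i, either c vanishes on all positions of A_{i,j}, or c has at least ρ_i nonzero coordinates in A_{i,j}. -/
lemma vand_aux {F ι : Type*} [Field F] [DecidableEq ι] (S : Finset ι) (v f : ι → F)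
    (hv : Set.InjOn v S) (h : ∀ s : ℕ, s < S.card → ∑ x ∈ S, f x * v x ^ s = 0) :
    ∀ x ∈ S, f x = 0 := by
  intro x hx
  set p : Polynomial F := ∏ y ∈ S.erase x, (Polynomial.X - Polynomial.C (v y)) with hp
  have hdeg : p.natDegree < S.card := by
    rw [hp, Polynomial.natDegree_prod_of_monic _ _ (fun y _ => Polynomial.monic_X_sub_C _)]
    simp only [Polynomial.natDegree_X_sub_C, Finset.sum_const, smul_eq_mul, mul_one]
    exact Finset.card_erase_lt_of_mem hx
  have h1 : ∑ y ∈ S, f y * p.eval (v y) = 0 := by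
    simp_rw [Polynomial.eval_eq_sum_range' hdeg, Finset.mul_sum]
    rw [Finset.sum_comm]
    apply Finset.sum_eq_zero
    intro k hk
    have := h k (Finset.mem_range.1 hk)
    calc _ = p.coeff k * ∑ y ∈ S, f y * v y ^ k := by
          rw [Finset.mul_sum]
          exact Finset.sum_congr rfl (fun y _ => by ring)
      _ = 0 := by rw [this, mul_zero]
  rw [Finset.sum_eq_single_of_mem x hx] at h1
  · rcases mul_eq_zero.1 h1 with h2 | h2
    · exact h2
    · exfalso
      rw [hp, Polynomial.eval_prod, Finset.prod_eq_zero_iff] at h2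
      obtain ⟨y, hy, h3⟩ := h2
      simp only [Polynomial.eval_sub, Polynomial.eval_X, Polynomial.eval_C] at h3
      rw [Finset.mem_erase] at hy
      exact hy.1 (hv hy.2 hx (sub_eq_zero.1 h3).symm)
  · intro y hy hne
    rw [hp, Polynomial.eval_prod, Finset.prod_eq_zero (i := y) (by simp [hne, hy])]
    · simp
    · simp

lemma loc_aux (F : Type*) [Field F] (n N M : ℕ) [NeZero n] (hnm : n = N * M)
    (hco : Nat.Coprime N M) (ρ : ℕ) (hρ : 2 ≤ ρ) (b l : ℤ) (hb : IsCoprime b (N : ℤ))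
    (α : F) (hα : IsPrimitiveRoot α n) (c : ZMod n → F)
    (hc : ∀ m : ZMod n, (∃ s : ℕ, s ≤ ρ - 2 ∧
      ((m.val : ZMod N) = (s : ZMod N) * (b : ZMod N) + (l : ZMod N))) →
      ∑ x : ZMod n, c x * α ^ (m.val * x.val) = 0)
    (j : ℕ) (hj : j < M) :
    (∀ x : ZMod n, (x.val : ZMod M) = (j : ZMod M) → c x = 0) ∨
      ρ ≤ Set.ncard {x : ZMod n | (x.val : ZMod M) = (j : ZMod M) ∧ c x ≠ 0} := by
  classical
  have hn0 : n ≠ 0 := NeZero.ne n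
  have hα0 : α ≠ 0 := hα.ne_zero hn0
  have hN0 : N ≠ 0 := by rintro rfl; simp at hnm; omega
  -- integer exponents
  have hint : ∀ (s : ℕ), s ≤ ρ - 2 → ∀ k : ℕ,
      ∑ x : ZMod n, c x * (α ^ (s * b + l + N * k : ℤ)) ^ x.val = 0 := by
    intro s hs k
    set z : ℤ := s * b + l + N * k with hz
    have hval : ((((z : ZMod n)).val : ℕ) : ℤ) = z % n := ZMod.val_intCast z
    have hpow : α ^ ((z : ZMod n)).val = α ^ z := by
      rw [← zpow_natCast, hval]
      conv_rhs => rw [← Int.emod_add_mul_ediv z n, zpow_add₀ hα0, zpow_mul, zpow_natCast,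
        hα.pow_eq_one, one_zpow, mul_one]
    have := hc (z : ZMod n) ⟨s, hs, by
      have h1 : ((((((z : ZMod n)).val : ℕ) : ℤ)) : ZMod N) = (z : ZMod N) := by
        rw [hval, ZMod.intCast_eq_intCast_iff]
        exact (Int.mod_modEq z n).of_dvd (by rw [hnm]; push_cast; exact dvd_mul_right _ _)
      rw [Int.cast_natCast] at h1
      rw [h1, hz]
      simp⟩
    rw [← this]
    refine Finset.sum_congr rfl (fun x _ => ?_)
    rw [pow_mul, hpow]
  have hβ : IsPrimitiveRoot (α ^ N) M := hα.pow (Nat.pos_of_ne_zero hn0) hnm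
  -- first Vandermonde
  have hfirst : ∀ s : ℕ, s ≤ ρ - 2 → ∀ r ∈ Finset.range M,
      ∑ x : ZMod n with x.val % M = r, c x * (α ^ (s * b + l : ℤ)) ^ x.val = 0 := by
    intro s hs
    apply vand_aux (Finset.range M) (fun r => (α ^ N) ^ r)
      (fun r => ∑ x : ZMod n with x.val % M = r, c x * (α ^ (s * b + l : ℤ)) ^ x.val)
    · intro a ha a' ha' h
      exact hβ.pow_inj (by simpa using ha) (by simpa using ha') h
    · intro k _
      rw [← hint s hs k, ← Finset.sum_fiberwise_of_maps_to (s := Finset.univ)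
        (t := Finset.range M) (g := fun x : ZMod n => x.val % M)
        (fun x _ => Finset.mem_range.2 (Nat.mod_lt _ (by omega)))]
      refine Finset.sum_congr rfl (fun r _ => ?_)
      rw [Finset.sum_mul]
      refine Finset.sum_congr rfl (fun x hx => ?_)
      have hxr : x.val % M = r := (Finset.mem_filter.1 hx).2
      have h2 : (α ^ N) ^ r = (α ^ N) ^ x.val := by
        rw [← hxr]
        conv_rhs => rw [← Nat.mod_add_div x.val M, pow_add, pow_mul _ M, hβ.pow_eq_one,
          one_pow, mul_one]
      rw [h2, zpow_add₀ hα0 (s * b + l), mul_pow, mul_assoc]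
      congr 2
      rw [zpow_mul, zpow_natCast, zpow_natCast]
      ring
  by_contra hcon
  push Not at hcon
  obtain ⟨⟨x0, hx0, hcx0⟩, hcard⟩ := hcon
  have hiff : ∀ x : ZMod n, (x.val : ZMod M) = (j : ZMod M) ↔ x.val % M = j := by
    intro x
    rw [ZMod.natCast_eq_natCast_iff, Nat.ModEq, Nat.mod_eq_of_lt hj]
  set S : Finset (ZMod n) := {x : ZMod n | x.val % M = j ∧ c x ≠ 0} with hS
  have hSc : S.card < ρ := by
    rw [← Set.ncard_coe_finset]
    have hSe : (S : Set (ZMod n)) = {x : ZMod n | (x.val : ZMod M) = (j : ZMod M) ∧ c x ≠ 0} := by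
      ext x
      rw [Finset.mem_coe, hS, Finset.mem_filter]
      exact ⟨fun h => ⟨(hiff x).2 h.2.1, h.2.2⟩,
        fun h => ⟨Finset.mem_univ _, (hiff x).1 h.1, h.2⟩⟩
    rw [hSe]
    exact hcard
  have hfin := vand_aux S (fun x => α ^ (b * x.val : ℤ)) (fun x => c x * (α ^ l) ^ x.val) ?_ ?_ x0
    (by simp [hS, (hiff x0).1 hx0, hcx0])
  · rcases mul_eq_zero.1 hfin with h | h
    · exact hcx0 h
    · exact pow_ne_zero _ (zpow_ne_zero _ hα0) h
  · intro x hx y hy h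
    have hx1 : x.val % M = j := by simp [hS] at hx; exact hx.1
    have hy1 : y.val % M = j := by simp [hS] at hy; exact hy.1
    have h1 : α ^ (b * x.val - b * y.val : ℤ) = 1 := by
      rw [zpow_sub₀ hα0]
      exact (div_eq_one_iff_eq (zpow_ne_zero _ hα0)).2 h
    rw [hα.zpow_eq_one_iff_dvd, ← mul_sub] at h1
    have hNd : (N : ℤ) ∣ (x.val - y.val : ℤ) :=
      hb.symm.dvd_of_dvd_mul_left (dvd_trans (by rw [hnm]; push_cast; exact dvd_mul_right _ _) h1)
    have hMd : (M : ℤ) ∣ (x.val - y.val : ℤ) :=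
      (Nat.modEq_iff_dvd.1 (show y.val ≡ x.val [MOD M] from hy1.trans hx1.symm))
    have hnd : (n : ℤ) ∣ (x.val - y.val : ℤ) := by
      have hnm' : (n : ℤ) = N * M := by exact_mod_cast hnm
      exact hnm'.dvd.trans (IsCoprime.mul_dvd (Nat.isCoprime_iff_coprime.2 hco) hNd hMd)
    have h3 : y.val ≡ x.val [MOD n] := Nat.modEq_iff_dvd.2 hnd
    rw [Nat.ModEq, Nat.mod_eq_of_lt (ZMod.val_lt _), Nat.mod_eq_of_lt (ZMod.val_lt _)] at h3
    exact (ZMod.val_injective n h3).symm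
  · intro s hs
    rw [← hfirst s (by omega) j (Finset.mem_range.2 hj)]
    have hsub : S ⊆ Finset.univ.filter (fun x : ZMod n => x.val % M = j) := by
      intro x hx
      simp [hS] at hx ⊢
      exact hx.1
    rw [← Finset.sum_subset hsub]
    · refine Finset.sum_congr rfl (fun x _ => ?_)
      rw [mul_assoc]
      congr 1
      simp only [← zpow_natCast, ← zpow_mul]
      rw [← zpow_add₀ hα0]
      congr 1
      ring
    · intro x hx hxS
      have : c x = 0 := by
        by_contra h
        exact hxS (by simp [hS] at hx ⊢; exact ⟨hx, h⟩)
      rw [this, zero_mul]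

/-- Locality of the construction: the cyclic code with defining set
`D_i = {m : ZMod n | m ≡ s·bᵢ + lᵢ (mod nᵢ) for some 0 ≤ s ≤ ρᵢ - 2}` has
`(nᵢ - ρᵢ + 1, ρᵢ)`-locality with respect to the partition into the sets
`A_{i,j} = {x : ZMod n | x ≡ j (mod n / nᵢ)}`: on each such set, every codeword
either vanishes identically or has at least `ρᵢ` nonzero coordinates. -/
theorem locality_of_construction (F : Type*) [Field F]
    (t : ℕ) (ht : 1 ≤ t)
    (ni : Fin t → ℕ) (hni : ∀ i, 2 ≤ ni i)
    (hcop : ∀ i j : Fin t, i ≠ j → Nat.Coprime (ni i) (ni j))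
    (n : ℕ) (hn : n = ∏ i, ni i) [NeZero n]
    (ρ : Fin t → ℕ) (hρ : ∀ i, 2 ≤ ρ i ∧ ρ i ≤ ni i)
    (b l : Fin t → ℤ) (hb : ∀ i, IsCoprime (b i) (ni i : ℤ))
    (α : F) (hα : IsPrimitiveRoot α n)
    (i : Fin t)
    (Di : Set (ZMod n))
    (hDi : Di = {m : ZMod n | ∃ s : ℕ, s ≤ ρ i - 2 ∧
      ((m.val : ZMod (ni i)) = (s : ZMod (ni i)) * ((b i : ZMod (ni i))) + (l i : ZMod (ni i)))})
    (c : ZMod n → F) (hc : c ∈ cyclicCode F n α Di)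
    (j : ℕ) (hj : j < n / ni i) :
    (∀ x : ZMod n, (x.val : ZMod (n / ni i)) = (j : ZMod (n / ni i)) → c x = 0) ∨
      ρ i ≤ Set.ncard {x : ZMod n |
        (x.val : ZMod (n / ni i)) = (j : ZMod (n / ni i)) ∧ c x ≠ 0} := by
  subst hDi
  have hprod : n = ni i * ∏ k ∈ Finset.univ.erase i, ni k := by
    rw [hn, Finset.mul_prod_erase _ _ (Finset.mem_univ i)]
  have hM : n / ni i = ∏ k ∈ Finset.univ.erase i, ni k := by
    rw [hprod]
    exact Nat.mul_div_cancel_left _ (by have := hni i; omega)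
  have hco : Nat.Coprime (ni i) (n / ni i) := by
    rw [hM]
    exact Nat.Coprime.prod_right (fun k hk => hcop i k (Finset.ne_of_mem_erase hk).symm)
  exact loc_aux F n (ni i) (n / ni i) (by rw [hM]; exact hprod) hco (ρ i) (hρ i).1 (b i) (l i)
    (hb i) α hα c (fun m hm => hc m hm) j hj
end

section
/- Global distance of the construction: Let D be any subset of ZMod n with D ⊇ D_1 ∪ ⋯ ∪ D_t, and let C = C(D). Then every nonzero codeword of C has Hamming weight at least ∏_{i=1}^t ρ_i. -/
theorem aux_comb {X ι κ : Type*} [DecidableEq X] [DecidableEq ι] (S : Finset X)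
    (p : ι → X → κ) (ρ : ι → ℕ)
    (h : ∀ i, ∀ x ∈ S, ∃ L : Finset X, L ⊆ S ∧ ρ i ≤ L.card ∧
      (∀ y ∈ L, ∀ j, j ≠ i → p j y = p j x) ∧ (∀ y ∈ L, ∀ z ∈ L, p i y = p i z → y = z))
    (J : Finset ι) : ∀ x ∈ S, ∃ T : Finset X, T ⊆ S ∧ ∏ i ∈ J, ρ i ≤ T.card ∧
      (∀ y ∈ T, ∀ j, j ∉ J → p j y = p j x) := by
  induction J using Finset.induction_on with
  | empty =>
    intro x hx
    exact ⟨{x}, by simpa using hx, by simp, by simp⟩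
  | insert i J hi ih =>
    intro x hx
    obtain ⟨L, hLS, hLc, hLe, hLd⟩ := h i x hx
    choose! T hTS hTc hTe using ih
    refine ⟨L.biUnion T, ?_, ?_, ?_⟩
    · intro y hy
      rw [Finset.mem_biUnion] at hy
      obtain ⟨a, ha, hy⟩ := hy
      exact hTS a (hLS ha) hy
    · rw [Finset.prod_insert hi, Finset.card_biUnion]
      · calc ρ i * ∏ j ∈ J, ρ j ≤ L.card * ∏ j ∈ J, ρ j := Nat.mul_le_mul_right _ hLc
          _ = ∑ _a ∈ L, ∏ j ∈ J, ρ j := by simp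
          _ ≤ _ := Finset.sum_le_sum (fun a ha => hTc a (hLS ha))
      · intro a ha b hb hab
        change Disjoint (T a) (T b)
        rw [Finset.disjoint_left]
        intro y hya hyb
        exact hab (hLd a ha b hb ((hTe a (hLS ha) y hya i hi).symm.trans
          (hTe b (hLS hb) y hyb i hi)))
    · intro y hy j hj
      rw [Finset.mem_biUnion] at hy
      obtain ⟨a, ha, hy⟩ := hy
      rw [Finset.mem_insert, not_or] at hj
      rw [hTe a (hLS ha) y hy j hj.2, hLe a ha j hj.1]

theorem aux_vdm {X F : Type*} [Field F] [DecidableEq X] (S : Finset X) (w v : X → F) (r : ℕ)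
    (hr : S.card ≤ r) (hv : ∀ x ∈ S, ∀ y ∈ S, v x = v y → x = y)
    (h : ∀ s < r, ∑ x ∈ S, w x * v x ^ s = 0) : ∀ x ∈ S, w x = 0 := by
  intro x hx
  set P : Polynomial F := ∏ y ∈ S.erase x, (Polynomial.X - Polynomial.C (v y)) with hP
  have hdeg : P.natDegree < r := by
    rw [hP, Polynomial.natDegree_prod_of_monic _ _ (fun y _ => Polynomial.monic_X_sub_C _)]
    simp only [Polynomial.natDegree_X_sub_C, Finset.sum_const, smul_eq_mul, mul_one]
    have := Finset.card_erase_lt_of_mem hx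
    omega
  have h1 : ∑ y ∈ S, w y * P.eval (v y) = 0 := by
    simp only [Polynomial.eval_eq_sum_range, Finset.mul_sum]
    rw [Finset.sum_comm]
    apply Finset.sum_eq_zero
    intro s hs
    rw [Finset.mem_range] at hs
    have := h s (by omega)
    calc _ = P.coeff s * ∑ y ∈ S, w y * v y ^ s := by
          rw [Finset.mul_sum]; apply Finset.sum_congr rfl; intros; ring
      _ = 0 := by rw [this, mul_zero]
  rw [Finset.sum_eq_single_of_mem x hx] at h1
  · rcases mul_eq_zero.1 h1 with h1 | h1
    · exact h1
    · rw [hP, Polynomial.eval_prod, Finset.prod_eq_zero_iff] at h1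
      obtain ⟨y, hy, h2⟩ := h1
      simp only [Polynomial.eval_sub, Polynomial.eval_X, Polynomial.eval_C] at h2
      rw [Finset.mem_erase] at hy
      exact absurd (hv x hx y hy.2 (sub_eq_zero.1 h2)).symm hy.1
  · intro y hy hyx
    rw [hP, Polynomial.eval_prod, Finset.prod_eq_zero (Finset.mem_erase.2 ⟨hyx, hy⟩) (by simp),
      mul_zero]

theorem aux_line {F : Type*} [Field F] (n : ℕ) [NeZero n] (a N : ℕ) (hn : n = a * N)
    (hc : Nat.Coprime a N) (α : F) (hα : IsPrimitiveRoot α n) (b l : ℤ) (hb : IsCoprime b (a : ℤ))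
    (r : ℕ) (c : ZMod n → F)
    (h : ∀ s < r, ∀ k : ℕ, ∑ x, c x * α ^ (((s : ℤ) * b + l + k * a) * (x.val : ℤ)) = 0)
    (x₀ : ZMod n) (hx₀ : c x₀ ≠ 0) (S : Finset (ZMod n))
    (hS : ∀ x, x ∈ S ↔ c x ≠ 0 ∧ (N : ℤ) ∣ (x.val : ℤ) - x₀.val) : r + 1 ≤ S.card := by
  classical
  by_contra hlt
  have hn0 : n ≠ 0 := NeZero.ne n
  have hα0 : α ≠ 0 := hα.ne_zero hn0
  have hnF : (n : F) ≠ 0 := (hα.neZero').out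
  have hNF : (N : F) ≠ 0 := by
    intro h0; apply hnF; rw [hn, Nat.cast_mul, h0, mul_zero]
  have hz : ∀ z : ℤ, α ^ z = 1 ↔ (n : ℤ) ∣ z := fun z => hα.zpow_eq_one_iff_dvd z
  have ha0 : (a : ℤ) ≠ 0 := by rintro h0; apply hn0; rw [hn]; simp_all
  have hgeo : ∀ z : ℤ, ∑ k ∈ Finset.range N, α ^ ((k : ℤ) * a * z) =
      if (N : ℤ) ∣ z then (N : F) else 0 := by
    intro z
    have e : ∀ k : ℕ, α ^ ((k : ℤ) * a * z) = (α ^ ((a : ℤ) * z)) ^ k := by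
      intro k; rw [← zpow_natCast, ← zpow_mul]; congr 1; ring
    simp only [e]
    have hd : α ^ ((a : ℤ) * z) = 1 ↔ (N : ℤ) ∣ z := by
      rw [hz, hn, Nat.cast_mul]; exact mul_dvd_mul_iff_left ha0
    split_ifs with hN
    · rw [hd.2 hN]; simp
    · have h1 : α ^ ((a : ℤ) * z) ≠ 1 := fun h1 => hN (hd.1 h1)
      rw [geom_sum_eq h1]
      have : (α ^ ((a : ℤ) * z)) ^ N = 1 := by
        rw [← zpow_natCast, ← zpow_mul, hz, hn, Nat.cast_mul]
        exact ⟨z, by ring⟩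
      rw [this]; simp
  have key := aux_vdm S (fun x => c x * α ^ (l * (x.val : ℤ))) (fun x => α ^ (b * (x.val : ℤ))) r
    (by omega) ?_ ?_ x₀ ((hS x₀).2 ⟨hx₀, by simp⟩)
  · exact mul_ne_zero hx₀ (zpow_ne_zero _ hα0) key
  · intro x hx y hy hxy
    have h1 : α ^ (b * ((x.val : ℤ) - y.val)) = 1 := by
      rw [mul_sub, zpow_sub₀ hα0, div_eq_one_iff_eq (zpow_ne_zero _ hα0)]; exact hxy
    rw [hz] at h1
    have h2 : (a : ℤ) ∣ (x.val : ℤ) - y.val :=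
      hb.symm.dvd_of_dvd_mul_left ((Dvd.intro (N : ℤ) (by rw [hn]; push_cast; rfl)).trans h1)
    have h3 : (N : ℤ) ∣ (x.val : ℤ) - y.val := by
      have := dvd_sub ((hS x).1 hx).2 ((hS y).1 hy).2
      simpa using this
    have h4 : (n : ℤ) ∣ (x.val : ℤ) - y.val := by
      have h4 := (Nat.isCoprime_iff_coprime.2 hc).mul_dvd h2 h3
      have h5 : (n : ℤ) = a * N := by exact_mod_cast hn
      rwa [h5]
    have h5 := (ZMod.intCast_zmod_eq_zero_iff_dvd _ n).2 h4
    · simpa [sub_eq_zero] using h5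
  · intro s hs
    have h1 : ∑ k ∈ Finset.range N, α ^ (-((k : ℤ) * a * x₀.val)) *
        ∑ x, c x * α ^ (((s : ℤ) * b + l + k * a) * (x.val : ℤ)) = 0 :=
      Finset.sum_eq_zero (fun k _ => by rw [h s hs k, mul_zero])
    simp only [Finset.mul_sum] at h1
    rw [Finset.sum_comm] at h1
    have h2 : ∀ x : ZMod n, ∑ k ∈ Finset.range N, α ^ (-((k : ℤ) * a * x₀.val)) *
        (c x * α ^ (((s : ℤ) * b + l + k * a) * (x.val : ℤ))) =
        N * (if x ∈ S then c x * α ^ (l * (x.val : ℤ)) * (α ^ (b * (x.val : ℤ))) ^ s else 0) := by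
      intro x
      have e : ∀ k : ℕ, α ^ (-((k : ℤ) * a * x₀.val)) *
        (c x * α ^ (((s : ℤ) * b + l + k * a) * (x.val : ℤ))) =
        (c x * α ^ (l * (x.val : ℤ)) * (α ^ (b * (x.val : ℤ))) ^ s) *
          α ^ ((k : ℤ) * a * ((x.val : ℤ) - x₀.val)) := by
        intro k
        rw [← zpow_natCast, ← zpow_mul, mul_left_comm, mul_assoc (c x), mul_assoc (c x),
          ← zpow_add₀ hα0, ← zpow_add₀ hα0, ← zpow_add₀ hα0]
        congr 2; ring
      simp only [e]
      rw [← Finset.mul_sum, hgeo]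
      simp only [hS]
      by_cases hcx : c x = 0
      · simp [hcx]
      · simp only [ne_eq, hcx, not_false_eq_true, true_and]
        split_ifs <;> ring
    simp only [h2] at h1
    rw [← Finset.mul_sum, mul_eq_zero] at h1
    have h3 := h1.resolve_left hNF
    rw [Finset.sum_ite_mem, Finset.univ_inter] at h3
    exact h3

/-- Global distance of the construction: if the defining set `D` contains all the local
defining sets `D_i = {m : ZMod n | m ≡ s·bᵢ + lᵢ (mod nᵢ) for some 0 ≤ s ≤ ρᵢ - 2}`,
then every nonzero codeword of the cyclic code `C(D)` has Hamming weight at least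
`∏ i, ρᵢ`. -/
theorem global_distance_of_construction (F : Type*) [Field F]
    (t : ℕ) (ht : 1 ≤ t)
    (ni : Fin t → ℕ) (hni : ∀ i, 2 ≤ ni i)
    (hcop : ∀ i j : Fin t, i ≠ j → Nat.Coprime (ni i) (ni j))
    (n : ℕ) (hn : n = ∏ i, ni i) [NeZero n]
    (ρ : Fin t → ℕ) (hρ : ∀ i, 2 ≤ ρ i ∧ ρ i ≤ ni i)
    (b l : Fin t → ℤ) (hb : ∀ i, IsCoprime (b i) (ni i : ℤ))
    (α : F) (hα : IsPrimitiveRoot α n)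
    (Di : Fin t → Set (ZMod n))
    (hDi : ∀ i, Di i = {m : ZMod n | ∃ s : ℕ, s ≤ ρ i - 2 ∧
      ((m.val : ZMod (ni i)) = (s : ZMod (ni i)) * ((b i : ZMod (ni i))) + (l i : ZMod (ni i)))})
    (D : Set (ZMod n)) (hD : (⋃ i, Di i) ⊆ D)
    (c : ZMod n → F) (hc : c ∈ cyclicCode F n α D) (hc0 : c ≠ 0) :
    (∏ i, ρ i) ≤ Set.ncard {x : ZMod n | c x ≠ 0} := by
  classical
  have hn0 : n ≠ 0 := NeZero.ne n
  have hα0 : α ≠ 0 := hα.ne_zero hn0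
  set S : Finset (ZMod n) := Finset.univ.filter (fun x => c x ≠ 0) with hSdef
  have hS : {x : ZMod n | c x ≠ 0} = (S : Set (ZMod n)) := by ext x; simp [hSdef]
  rw [hS, Set.ncard_coe_finset]
  obtain ⟨x, hx⟩ : ∃ x, c x ≠ 0 := by
    by_contra hcon
    push Not at hcon
    exact hc0 (funext hcon)
  suffices hh : ∀ i, ∀ x ∈ S, ∃ L : Finset (ZMod n), L ⊆ S ∧ ρ i ≤ L.card ∧
      (∀ y ∈ L, ∀ j, j ≠ i → y.val % ni j = x.val % ni j) ∧
      (∀ y ∈ L, ∀ z ∈ L, y.val % ni i = z.val % ni i → y = z) by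
    obtain ⟨T, hTS, hTc, -⟩ := aux_comb S (fun i x => (x.val % ni i : ℕ)) ρ hh Finset.univ x
      (by simp [hSdef, hx])
    exact hTc.trans (Finset.card_le_card hTS)
  intro i x hx
  have hN : n = ni i * ∏ j ∈ Finset.univ.erase i, ni j := by
    rw [hn, Finset.mul_prod_erase _ _ (Finset.mem_univ i)]
  have hcopN : Nat.Coprime (ni i) (∏ j ∈ Finset.univ.erase i, ni j) :=
    Nat.Coprime.prod_right (fun j hj => hcop i j (Finset.ne_of_mem_erase hj).symm)
  have hdvd : ni i ∣ n := ⟨_, hN⟩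
  set N := ∏ j ∈ Finset.univ.erase i, ni j with hNdef
  have hxc : c x ≠ 0 := by simpa [hSdef] using hx
  refine ⟨S.filter (fun y => (N : ℤ) ∣ (y.val : ℤ) - x.val), Finset.filter_subset _ _, ?_, ?_, ?_⟩
  · have := aux_line n (ni i) N hN hcopN α hα (b i) (l i) (hb i) (ρ i - 1) c ?_ x hxc
      (S.filter (fun y => (N : ℤ) ∣ (y.val : ℤ) - x.val)) (by intro y; simp [hSdef])
    · have := (hρ i).1
      omega
    · intro s hs k
      set M : ℤ := (s : ℤ) * b i + l i + k * ni i with hM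
      have hv : (n : ℤ) ∣ M - ((M : ZMod n).val : ℤ) := by
        rw [← ZMod.intCast_zmod_eq_zero_iff_dvd]
        simp
      have hmem : (M : ZMod n) ∈ D := by
        apply hD
        rw [Set.mem_iUnion]
        refine ⟨i, ?_⟩
        rw [hDi i]
        refine ⟨s, by omega, ?_⟩
        have h2 : ((ni i : ℕ) : ℤ) ∣ M - ((M : ZMod n).val : ℤ) :=
          (Int.natCast_dvd_natCast.2 hdvd).trans hv
        rw [← ZMod.intCast_zmod_eq_zero_iff_dvd, Int.cast_sub, sub_eq_zero] at h2
        rw [Int.cast_natCast] at h2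
        rw [← h2, hM]
        simp
      have h3 := hc _ hmem
      rw [← h3]
      apply Finset.sum_congr rfl
      intro y _
      congr 1
      rw [← zpow_natCast, ← div_eq_one_iff_eq (zpow_ne_zero _ hα0), ← zpow_sub₀ hα0,
        hα.zpow_eq_one_iff_dvd]
      push_cast
      rw [← sub_mul]
      exact hv.mul_right _
  · intro y hy j hj
    have h1 := (Finset.mem_filter.1 hy).2
    have h2 : ((ni j : ℕ) : ℤ) ∣ (y.val : ℤ) - x.val :=
      (Int.natCast_dvd_natCast.2
        (Finset.dvd_prod_of_mem ni (Finset.mem_erase.2 ⟨hj, Finset.mem_univ j⟩))).trans h1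
    exact ((Nat.modEq_iff_dvd.2 h2).symm : _)
  · intro y hy z hz hyz
    have h1 := (Finset.mem_filter.1 hy).2
    have h2 := (Finset.mem_filter.1 hz).2
    have h3 : (N : ℤ) ∣ (z.val : ℤ) - y.val := by
      have := dvd_sub h2 h1
      simpa using this
    have h4 : ((ni i : ℕ) : ℤ) ∣ (z.val : ℤ) - y.val := Nat.modEq_iff_dvd.1 hyz
    have h5 : (n : ℤ) ∣ (z.val : ℤ) - y.val := by
      have h5 := (Nat.isCoprime_iff_coprime.2 hcopN).mul_dvd h4 h3
      have h6 : (n : ℤ) = ni i * N := by exact_mod_cast hN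
      rwa [h6]
    have h6 := (ZMod.intCast_zmod_eq_zero_iff_dvd _ n).2 h5
    have h7 : z - y = 0 := by simpa using h6
    exact (sub_eq_zero.1 h7).symm
end

section
/- Dimension of the construction without global zeros: Let D = D_1 ∪ ⋯ ∪ D_t. Then the F-vector-space dimension of the cyclic code C(D) equals ∏_{i=1}^t (n_i − ρ_i + 1). -/
theorem aux_code (F : Type*) [Field F] (n : ℕ) [NeZero n] (α : F) (hα : IsPrimitiveRoot α n)
    (D : Set (ZMod n)) :
    Module.finrank F (cyclicCode F n α D) = Nat.card {m : ZMod n // m ∉ D} := by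
  classical
  let M : Matrix (ZMod n) (ZMod n) F := Matrix.of fun m x => α ^ (m.val * x.val)
  have hM : IsUnit M.det := by
    obtain ⟨k, rfl⟩ := Nat.exists_eq_succ_of_ne_zero (NeZero.ne n)
    have : M = Matrix.vandermonde (fun i : Fin (k+1) => α ^ (i : ℕ)) := by
      ext i j
      exact pow_mul α _ _
    rw [isUnit_iff_ne_zero, this]
    refine Matrix.det_vandermonde_ne_zero_iff.2 ?_
    intro i j hij
    exact Fin.ext (hα.pow_inj i.2 j.2 hij)
  have hval : ∀ c m, (M.mulVec c) m = ∑ x : ZMod n, c x * α ^ (m.val * x.val) := by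
    intro c m
    simp [M, Matrix.mulVec, dotProduct, mul_comm]
  have hMu : IsUnit M := (Matrix.isUnit_iff_isUnit_det M).2 hM
  let f : cyclicCode F n α D →ₗ[F] ({m : ZMod n // m ∉ D} → F) :=
    (LinearMap.funLeft F F Subtype.val) ∘ₗ M.mulVecLin ∘ₗ (cyclicCode F n α D).subtype
  have hf : ∀ c m, f c m = M.mulVec c.1 m.1 := fun c m => rfl
  have hbij : Function.Bijective f := by
    constructor
    · rw [injective_iff_map_eq_zero]
      intro c hc
      have h0 : M.mulVec c.1 = M.mulVec 0 := by
        rw [Matrix.mulVec_zero]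
        ext m
        by_cases hm : m ∈ D
        · rw [hval]; exact c.2 m hm
        · exact congrFun hc ⟨m, hm⟩
      exact Subtype.ext (Matrix.mulVec_injective_iff_isUnit.2 hMu h0)
    · intro g
      let g' : ZMod n → F := fun m => if h : m ∈ D then 0 else g ⟨m, h⟩
      obtain ⟨c, hc⟩ := Matrix.mulVec_surjective_iff_isUnit.2 hMu g'
      refine ⟨⟨c, ?_⟩, ?_⟩
      · intro m hm
        rw [← hval, hc]; simp [g', hm]
      · ext m
        rw [hf]
        simp only [hc]
        simp [g', m.2]
  rw [(LinearEquiv.ofBijective f hbij).finrank_eq, Module.finrank_pi, Nat.card_eq_fintype_card]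

theorem aux_count (n ρ : ℕ) (hn : 2 ≤ n) (h2 : 2 ≤ ρ) (hρ : ρ ≤ n) (b l : ℤ)
    (hb : IsCoprime b (n : ℤ)) :
    Nat.card {m : ZMod n // ¬ ∃ s : ℕ, s ≤ ρ - 2 ∧
      m = (s : ZMod n) * (b : ZMod n) + (l : ZMod n)} = n - ρ + 1 := by
  classical
  haveI : NeZero n := ⟨by omega⟩
  have hu : IsUnit (b : ZMod n) := by
    obtain ⟨u, v, huv⟩ := hb
    have := congrArg (Int.cast : ℤ → ZMod n) huv
    push_cast at this
    simp only [ZMod.natCast_self, mul_zero, add_zero] at this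
    exact IsUnit.of_mul_eq_one_right _ this
  let S : Finset (ZMod n) := (Finset.range (ρ - 1)).image
    fun s : ℕ => (s : ZMod n) * (b : ZMod n) + (l : ZMod n)
  have hS : S.card = ρ - 1 := by
    rw [Finset.card_image_of_injOn, Finset.card_range]
    intro s hs s' hs' h
    simp only [Finset.coe_range, Set.mem_Iio] at hs hs'
    have h1 := hu.mul_right_cancel (add_right_cancel h)
    rw [ZMod.natCast_eq_natCast_iff'] at h1
    rwa [Nat.mod_eq_of_lt (by omega), Nat.mod_eq_of_lt (by omega)] at h1
  have : ∀ m : ZMod n, (¬ ∃ s : ℕ, s ≤ ρ - 2 ∧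
      m = (s : ZMod n) * (b : ZMod n) + (l : ZMod n)) ↔ m ∈ Sᶜ := by
    intro m
    simp only [S, Finset.mem_compl, Finset.mem_image, Finset.mem_range, not_iff_not]
    constructor
    · rintro ⟨s, h, rfl⟩; exact ⟨s, by omega, rfl⟩
    · rintro ⟨s, h, rfl⟩; exact ⟨s, by omega, rfl⟩
  rw [Nat.card_congr (Equiv.subtypeEquivRight this), Nat.card_eq_fintype_card,
    Fintype.card_coe, Finset.card_compl, ZMod.card, hS]
  omega

/-- Dimension of the construction without global zeros: the cyclic code with defining set
`D = D₁ ∪ ⋯ ∪ D_t`, where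
`D_i = {m : ZMod n | m ≡ s·bᵢ + lᵢ (mod nᵢ) for some 0 ≤ s ≤ ρᵢ - 2}`,
has `F`-dimension `∏ i, (nᵢ - ρᵢ + 1)`. -/
theorem dimension_of_construction (F : Type*) [Field F]
    (t : ℕ) (ht : 1 ≤ t)
    (ni : Fin t → ℕ) (hni : ∀ i, 2 ≤ ni i)
    (hcop : ∀ i j : Fin t, i ≠ j → Nat.Coprime (ni i) (ni j))
    (n : ℕ) (hn : n = ∏ i, ni i) [NeZero n]
    (ρ : Fin t → ℕ) (hρ : ∀ i, 2 ≤ ρ i ∧ ρ i ≤ ni i)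
    (b l : Fin t → ℤ) (hb : ∀ i, IsCoprime (b i) (ni i : ℤ))
    (α : F) (hα : IsPrimitiveRoot α n)
    (Di : Fin t → Set (ZMod n))
    (hDi : ∀ i, Di i = {m : ZMod n | ∃ s : ℕ, s ≤ ρ i - 2 ∧
      ((m.val : ZMod (ni i)) = (s : ZMod (ni i)) * ((b i : ZMod (ni i))) + (l i : ZMod (ni i)))}) :
    Module.finrank F (cyclicCode F n α (⋃ i, Di i)) = ∏ i, (ni i - ρ i + 1) := by
  rw [aux_code F n α hα]
  subst hn
  have e := ZMod.prodEquivPi ni (fun i j h => hcop i j h)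
  have he : ∀ m i, e m i = ((m.val : ℕ) : ZMod (ni i)) := by
    intro m i
    conv_lhs => rw [← ZMod.natCast_zmod_val m]
    rw [map_natCast, Pi.natCast_apply]
  have e2 : {m : ZMod (∏ i, ni i) // m ∉ ⋃ i, Di i} ≃
      {g : ∀ i, ZMod (ni i) // ∀ i, ¬ ∃ s : ℕ, s ≤ ρ i - 2 ∧
        g i = (s : ZMod (ni i)) * (b i : ZMod (ni i)) + (l i : ZMod (ni i))} := by
    refine e.toEquiv.subtypeEquiv ?_
    intro m
    simp only [Set.mem_iUnion, hDi, Set.mem_setOf_eq, not_exists, RingEquiv.toEquiv_eq_coe,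
      RingEquiv.coe_toEquiv, he]
  rw [Nat.card_congr (e2.trans (Equiv.subtypePiEquivPi (p := fun i (g : ZMod (ni i)) => ¬ ∃ s : ℕ, s ≤ ρ i - 2 ∧
        g = (s : ZMod (ni i)) * (b i : ZMod (ni i)) + (l i : ZMod (ni i))))), Nat.card_pi]
  exact Finset.prod_congr rfl fun i _ =>
    aux_count (ni i) (ρ i) (hni i) (hρ i).1 (hρ i).2 (b i) (l i) (hb i)
end

section
/- Cardinality of the union of the local defining sets: The set D_1 ∪ ⋯ ∪ D_t ⊆ ZMod n has cardinality n − ∏_{i=1}^t (n_i − ρ_i + 1). -/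
lemma local_card (N r : ℕ) [NeZero N] (h2 : 2 ≤ r) (hr : r ≤ N) (b l : ℤ)
    (hb : IsCoprime b (N : ℤ)) :
    ((Finset.range (r - 1)).image
      (fun s : ℕ => (s : ZMod N) * (b : ZMod N) + (l : ZMod N)))ᶜ.card = N - r + 1 := by
  have hu : IsUnit (b : ZMod N) := by
    obtain ⟨u, v, huv⟩ := hb
    have h := congrArg (Int.cast : ℤ → ZMod N) huv
    push_cast at h
    rw [ZMod.natCast_self, mul_zero, add_zero] at h
    exact IsUnit.of_mul_eq_one_right _ h
  rw [Finset.card_compl, ZMod.card, Finset.card_image_of_injOn, Finset.card_range]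
  · omega
  · intro x hx y hy hxy
    simp only [Finset.coe_range, Set.mem_Iio] at hx hy
    have h1 : (x : ZMod N) = y := hu.mul_right_cancel (add_right_cancel hxy)
    rw [ZMod.natCast_eq_natCast_iff] at h1
    exact Nat.ModEq.eq_of_lt_of_lt h1 (by omega) (by omega)

/-- Cardinality of the union of the local defining sets: with
`D_i = {m : ZMod n | m ≡ s·bᵢ + lᵢ (mod nᵢ) for some 0 ≤ s ≤ ρᵢ - 2}`,
for pairwise coprime `nᵢ ≥ 2`, `n = ∏ nᵢ`, `2 ≤ ρᵢ ≤ nᵢ` and `bᵢ` coprime to `nᵢ`,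
the union `D₁ ∪ ⋯ ∪ D_t` has cardinality `n - ∏ i, (nᵢ - ρᵢ + 1)`. -/
theorem card_union_local_defining_sets
    (t : ℕ) (ht : 1 ≤ t)
    (ni : Fin t → ℕ) (hni : ∀ i, 2 ≤ ni i)
    (hcop : ∀ i j : Fin t, i ≠ j → Nat.Coprime (ni i) (ni j))
    (n : ℕ) (hn : n = ∏ i, ni i)
    (ρ : Fin t → ℕ) (hρ : ∀ i, 2 ≤ ρ i ∧ ρ i ≤ ni i)
    (b l : Fin t → ℤ) (hb : ∀ i, IsCoprime (b i) (ni i : ℤ))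
    (Di : Fin t → Set (ZMod n))
    (hDi : ∀ i, Di i = {m : ZMod n | ∃ s : ℕ, s ≤ ρ i - 2 ∧
      ((m.val : ZMod (ni i)) = (s : ZMod (ni i)) * ((b i : ZMod (ni i))) + (l i : ZMod (ni i)))}) :
    (⋃ i, Di i).ncard = n - ∏ i, (ni i - ρ i + 1) := by
  classical
  subst hn
  have hne : ∀ i, NeZero (ni i) := fun i => ⟨by have := hni i; omega⟩
  have hN : NeZero (∏ i, ni i) := ⟨Finset.prod_ne_zero_iff.2 fun i _ => (hne i).out⟩
  let F : ∀ i, Finset (ZMod (ni i)) := fun i => ((Finset.range (ρ i - 1)).image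
      (fun s : ℕ => (s : ZMod (ni i)) * (b i : ZMod (ni i)) + (l i : ZMod (ni i))))ᶜ
  let e := ZMod.prodEquivPi ni (fun i j h => hcop i j h)
  have hmem : ∀ m i, m ∈ Di i ↔ e m i ∉ F i := by
    intro m i
    have h1 : e m i = (m.val : ZMod (ni i)) := by
      refine (ZMod.prodEquivPi_apply ni (fun i j h => hcop i j h) m i).trans ?_
      rw [ZMod.natCast_val, ZMod.castHom_apply]
    rw [hDi, h1]
    simp only [F, Set.mem_ofPred_eq, Finset.mem_compl, not_not, Finset.mem_image, Finset.mem_range]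
    have := hρ i
    constructor
    · rintro ⟨s, hs, h⟩
      exact ⟨s, by omega, h.symm⟩
    · rintro ⟨s, hs, h⟩
      exact ⟨s, by omega, h.symm⟩
  have hset : (⋃ i, Di i)ᶜ = e.symm '' (Fintype.piFinset F : Set (∀ i, ZMod (ni i))) := by
    ext m
    constructor
    · intro hm
      refine ⟨e m, ?_, e.symm_apply_apply m⟩
      simp only [Set.mem_compl_iff, Set.mem_iUnion, not_exists, hmem, not_not] at hm
      simpa using hm
    · rintro ⟨x, hx, rfl⟩
      simp only [Set.mem_compl_iff, Set.mem_iUnion, not_exists, hmem, not_not,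
        RingEquiv.apply_symm_apply]
      simpa using hx
  have hc : (⋃ i, Di i)ᶜ.ncard = ∏ i, (ni i - ρ i + 1) := by
    rw [hset, Set.ncard_image_of_injective _ e.symm.injective, Set.ncard_coe_finset,
      Fintype.card_piFinset]
    exact Finset.prod_congr rfl fun i _ =>
      local_card (ni i) (ρ i) (hρ i).1 (hρ i).2 (b i) (l i) (hb i)
  have := Set.ncard_add_ncard_compl (⋃ i, Di i)
  rw [hc, Nat.card_zmod] at this
  omega
end

section
/- For t = 2 and ρ_1 = ρ_2 = 2, with n_1 and n_2 distinct primes, the Hartmann–Tzeng pattern applies to the defining set D = D_1 ∪ D_2: there exist u, z1, z2 ∈ ZMod n such that z1 and z2 are units of ZMod n and u + s1·z1 + s2·z2 ∈ D for all s1, s2 ∈ {0, 1}. Consequently, every nonzero codeword of the cyclic code C(D) has Hamming weight at least 4. -/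
/-- For `t = 2`, `ρ₁ = ρ₂ = 2` and distinct primes `n₁, n₂` with `n = n₁·n₂`, the
Hartmann–Tzeng pattern applies to `D = D₁ ∪ D₂`, where
`D_i = {m : ZMod n | m ≡ lᵢ (mod nᵢ)}`: there exist `u, z₁, z₂ ∈ ZMod n` with `z₁, z₂`
units such that `u + s₁·z₁ + s₂·z₂ ∈ D` for all `s₁, s₂ ∈ {0, 1}`. Consequently every
nonzero codeword of the cyclic code `C(D)` has Hamming weight at least `4`. -/
theorem hartmann_tzeng_pattern_t2 (F : Type*) [Field F]
    (n1 n2 : ℕ) (hn1 : n1.Prime) (hn2 : n2.Prime) (hne : n1 ≠ n2)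
    (n : ℕ) (hn : n = n1 * n2) [NeZero n]
    (b1 b2 l1 l2 : ℤ) (hb1 : IsCoprime b1 (n1 : ℤ)) (hb2 : IsCoprime b2 (n2 : ℤ))
    (α : F) (hα : IsPrimitiveRoot α n)
    (D1 D2 : Set (ZMod n))
    (hD1 : D1 = {m : ZMod n | (m.val : ZMod n1) = (l1 : ZMod n1)})
    (hD2 : D2 = {m : ZMod n | (m.val : ZMod n2) = (l2 : ZMod n2)})
    (D : Set (ZMod n)) (hD : D = D1 ∪ D2) :
    (∃ u z1 z2 : ZMod n, IsUnit z1 ∧ IsUnit z2 ∧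
      ∀ s1 s2 : ℕ, s1 ≤ 1 → s2 ≤ 1 →
        u + (s1 : ZMod n) * z1 + (s2 : ZMod n) * z2 ∈ D) ∧
    ∀ c : ZMod n → F, c ∈ cyclicCode F n α D → c ≠ 0 →
      4 ≤ Set.ncard {x : ZMod n | c x ≠ 0} := by
  subst hn
  have hcop : Nat.Coprime n1 n2 := (Nat.coprime_primes hn1 hn2).2 hne
  have : Fact n1.Prime := ⟨hn1⟩
  have : Fact n2.Prime := ⟨hn2⟩
  let e := ZMod.chineseRemainder hcop
  have he : ∀ m : ZMod (n1 * n2), e m = ((m.val : ZMod n1), (m.val : ZMod n2)) := by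
    intro m
    conv_lhs => rw [← ZMod.natCast_zmod_val m]
    rw [map_natCast]
    rfl
  have hmem : ∀ m : ZMod (n1 * n2), m ∈ D ↔ (e m).1 = l1 ∨ (e m).2 = l2 := by
    intro m
    rw [hD, hD1, hD2, he]
    rfl
  have key : ∃ u z1 z2 : ZMod (n1 * n2), IsUnit z1 ∧ IsUnit z2 ∧
      ∀ s1 s2 : ℕ, s1 ≤ 1 → s2 ≤ 1 →
        u + (s1 : ZMod (n1 * n2)) * z1 + (s2 : ZMod (n1 * n2)) * z2 ∈ D := by
    refine ⟨e.symm (l1, l2 - 1), 1, e.symm (-1, 1), isUnit_one, ?_, ?_⟩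
    · apply IsUnit.map
      rw [Prod.isUnit_iff]
      exact ⟨isUnit_one.neg, isUnit_one⟩
    · intro s1 s2 h1 h2
      rw [hmem]
      simp only [map_add, map_mul, RingEquiv.apply_symm_apply, map_natCast, map_one,
        Prod.fst_add, Prod.snd_add, Prod.fst_mul, Prod.snd_mul, Prod.fst_natCast,
        Prod.snd_natCast, Prod.fst_one, Prod.snd_one]
      interval_cases s1 <;> interval_cases s2 <;> simp
  refine ⟨key, ?_⟩
  obtain ⟨u, z1, z2, hz1, hz2, hp⟩ := key
  intro c hc hc0
  have hα1 : α ^ (n1 * n2) = 1 := hα.pow_eq_one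
  let g : ZMod (n1 * n2) → F := fun m => α ^ m.val
  have gmod : ∀ k : ℕ, α ^ (k % (n1 * n2)) = α ^ k := fun k => by
    rw [hα.eq_orderOf, pow_mod_orderOf]
  have gadd : ∀ a b, g (a + b) = g a * g b := fun a b => by
    simp only [g, ZMod.val_add, gmod, pow_add]
  have gmul : ∀ m x : ZMod (n1 * n2), α ^ (m.val * x.val) = g (m * x) := fun a b => by
    simp only [g, ZMod.val_mul, gmod]
  have ginj : Function.Injective g := fun a b h =>
    ZMod.val_injective _ (hα.pow_inj (ZMod.val_lt a) (ZMod.val_lt b) h)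
  have g0 : ∀ a, g a ≠ 0 := fun a => pow_ne_zero _ (hα.ne_zero (NeZero.ne _))
  have hs : ∀ m ∈ D, ∑ x : ZMod (n1 * n2), c x * g (m * x) = 0 := by
    intro m hm
    simpa only [gmul] using hc m hm
  by_contra hlt
  push Not at hlt
  classical
  have hn6 : 3 ≤ n1 * n2 := by
    have := hn1.two_le
    have := hn2.two_le
    nlinarith
  have hcard : (Finset.univ.filter (fun x => c x ≠ 0)).card ≤ 3 := by
    rw [Set.ncard_eq_toFinset_card'] at hlt
    simp only [Set.toFinset_setOf] at hlt
    omega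
  obtain ⟨T, hT, hT3⟩ := Finset.exists_superset_card_eq hcard
    (by rw [ZMod.card]; exact hn6)
  have hcT : ∀ x, x ∉ T → c x = 0 := by
    intro x hx
    by_contra h
    exact hx (hT (by simpa using h))
  have hs' : ∀ m ∈ D, ∑ x ∈ T, c x * g (m * x) = 0 := by
    intro m hm
    rw [← hs m hm]
    apply Finset.sum_subset (Finset.subset_univ _)
    intro x _ hx
    rw [hcT x hx, zero_mul]
  have main : ∀ x y w, x ≠ y → x ≠ w → y ≠ w → T = {x, y, w} → c x = 0 := by
    intro x y w hxy hxw hyw hTe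
    have hS : ∀ m ∈ D, c x * g (m * x) + (c y * g (m * y) + c w * g (m * w)) = 0 := by
      intro m hm
      have := hs' m hm
      rwa [hTe, Finset.sum_insert (by simp [hxy, hxw]), Finset.sum_pair hyw] at this
    have h00 := hS _ (hp 0 0 (by simp) (by simp))
    have h10 := hS _ (hp 1 0 (by simp) (by simp))
    have h01 := hS _ (hp 0 1 (by simp) (by simp))
    have h11 := hS _ (hp 1 1 (by simp) (by simp))
    simp only [Nat.cast_zero, Nat.cast_one, zero_mul, one_mul, add_zero, add_mul, gadd]
      at h00 h10 h01 h11
    have hA : g (z1 * x) - g (z1 * w) ≠ 0 :=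
      sub_ne_zero.2 fun h => hxw (hz1.mul_left_cancel (ginj h))
    have hB : g (z2 * x) - g (z2 * y) ≠ 0 :=
      sub_ne_zero.2 fun h => hxy (hz2.mul_left_cancel (ginj h))
    have : c x * (g (u * x) * ((g (z1 * x) - g (z1 * w)) * (g (z2 * x) - g (z2 * y)))) = 0 := by
      linear_combination h11 - g (z1 * w) * h01 - g (z2 * y) * h10
        + g (z1 * w) * g (z2 * y) * h00
    exact (mul_eq_zero.1 this).resolve_right (mul_ne_zero (g0 _) (mul_ne_zero hA hB))
  obtain ⟨x, y, w, hxy, hxw, hyw, hTe⟩ := Finset.card_eq_three.1 hT3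
  apply hc0
  funext v
  by_cases hv : v ∈ T
  · rw [hTe] at hv
    simp only [Finset.mem_insert, Finset.mem_singleton] at hv
    rcases hv with rfl | rfl | rfl
    · exact main _ y w hxy hxw hyw hTe
    · exact main _ x w hxy.symm hyw hxw (by rw [hTe]; ext; simp; tauto)
    · exact main _ x y hxw.symm hyw.symm hxy (by rw [hTe]; ext; simp; tauto)
  · exact hcT v hv
end

section
/- Bound on the dimension of codes with strong availability: Let C have line-distance ρ in every direction i, where 2 ≤ ρ ≤ min_i n_i, the n_i are pairwise coprime, and n_1 ≤ n_2 ≤ ⋯ ≤ n_t. Assume C ≠ {0} and let d be the minimum Hamming weight of a nonzero codeword of C. Let ξ ∈ {0, 1, …, t−1} be the smallest integer such that n_{ξ+1} > ⌊((d − 1)/∏_{i=1}^{ξ} n_i)^{1/(t−ξ)}⌋, set v = ⌊((d − 1)/∏_{i=1}^{ξ} n_i)^{1/(t−ξ)}⌋, and assume v ≥ ρ + 1. Then dim_F C ≤ ∏_{i=1}^{t} (n_i − ρ + 1) − (v − ρ − 1)^{t−ξ} · ∏_{i=1}^{ξ} (n_i − ρ + 1). -/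
/-- `C` has line-distance `ρ` in direction `i`: every codeword that is nonzero at some
point of a line in direction `i` (the set of points agreeing with a fixed point in all
coordinates except the `i`-th) has at least `ρ` nonzero coordinates on that line. -/
def HasLineDist (F : Type*) [Field F] {t : ℕ} (ni : Fin t → ℕ)
    (C : Submodule F ((∀ i, ZMod (ni i)) → F)) (i : Fin t) (ρ : ℕ) : Prop :=
  ∀ c ∈ C, ∀ a : ∀ i, ZMod (ni i),
    (∃ x : ∀ i, ZMod (ni i), (∀ l, l ≠ i → x l = a l) ∧ c x ≠ 0) →
    ρ ≤ Set.ncard {x : ∀ i, ZMod (ni i) | (∀ l, l ≠ i → x l = a l) ∧ c x ≠ 0}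

theorem box_aux {ι : Type*} [DecidableEq ι] {α : ι → Type*} (I : ∀ i, Finset (α i))
    (Z : (∀ i, α i) → Prop)
    (hline : ∀ i (a : ∀ i, α i), (∀ s ∈ I i, Z (Function.update a i s)) → Z a)
    (S : Finset ι) : ∀ a : ∀ i, α i,
      (∀ y : ∀ i, α i, (∀ i ∈ S, y i ∈ I i) → (∀ i, i ∉ S → y i = a i) → Z y) → Z a := by
  induction S using Finset.induction_on with
  | empty =>
    intro a h
    exact h a (by simp) (by simp)
  | insert i S hi ih =>
    intro a h
    apply ih
    intro y hy1 hy2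
    apply hline i
    intro s hs
    apply h
    · intro j hj
      by_cases hji : j = i
      · subst hji
        simpa using hs
      · rw [Function.update_of_ne hji]
        exact hy1 j (Finset.mem_of_mem_insert_of_ne hj hji)
    · intro j hj
      have hj' : j ≠ i ∧ j ∉ S := by simpa using hj
      rw [Function.update_of_ne hj'.1]
      exact hy2 j hj'.2

theorem dim_aux (F : Type*) [Field F] (t : ℕ) (ni : Fin t → ℕ) (hni : ∀ i, 2 ≤ ni i)
    (C : Submodule F ((∀ i, ZMod (ni i)) → F)) (ρ : ℕ) (hρ2 : 2 ≤ ρ)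
    (hloc : ∀ i, HasLineDist F ni C i ρ) (d : ℕ)
    (hd : ∀ c ∈ C, c ≠ 0 → d ≤ Set.ncard {x : ∀ i, ZMod (ni i) | c x ≠ 0})
    (b : Fin t → ℕ) (hb1 : ∀ i, ρ ≤ b i) (hb2 : ∀ i, b i ≤ ni i) (hb3 : ∏ i, b i < d) :
    Module.finrank F C ≤ (∏ i, (ni i - ρ + 1)) - ∏ i, (b i - ρ + 1) := by
  classical
  have : ∀ i, NeZero (ni i) := fun i => ⟨by have := hni i; omega⟩
  have hB : ∀ i, ∃ B : Finset (ZMod (ni i)), B.card = b i := by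
    intro i
    obtain ⟨B, -, h⟩ := Finset.exists_subset_card_eq
      (s := (Finset.univ : Finset (ZMod (ni i)))) (n := b i)
      (by rw [Finset.card_univ, ZMod.card]; exact hb2 i)
    exact ⟨B, h⟩
  choose B hBc using hB
  have hJ : ∀ i, ∃ J : Finset (ZMod (ni i)), J ⊆ B i ∧ J.card = b i - ρ + 1 := by
    intro i
    exact Finset.exists_subset_card_eq (by rw [hBc]; have := hb1 i; omega)
  choose J hJB hJc using hJ
  let I : ∀ i, Finset (ZMod (ni i)) := fun i => (B i)ᶜ ∪ J i
  have hIc : ∀ i, (I i).card = ni i - ρ + 1 := by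
    intro i
    have hdis : Disjoint (B i)ᶜ (J i) :=
      Finset.disjoint_of_subset_right (hJB i) disjoint_compl_left
    simp only [I]
    rw [Finset.card_union_of_disjoint hdis, Finset.card_compl, ZMod.card, hBc, hJc]
    have := hb1 i
    have := hb2 i
    omega
  have hIB : ∀ i, I i ∩ B i = J i := by
    intro i
    ext x
    have := @hJB i x
    simp only [I, Finset.mem_inter, Finset.mem_union, Finset.mem_compl]
    tauto
  let T : Finset (∀ i, ZMod (ni i)) := Fintype.piFinset I \ Fintype.piFinset B
  have hTc : T.card = (∏ i, (ni i - ρ + 1)) - ∏ i, (b i - ρ + 1) := by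
    have hinter : Fintype.piFinset B ∩ Fintype.piFinset I = Fintype.piFinset J := by
      ext x
      simp only [Finset.mem_inter, Fintype.mem_piFinset, ← hIB]
      constructor
      · rintro ⟨h1, h2⟩ i
        exact ⟨h2 i, h1 i⟩
      · intro h
        exact ⟨fun i => (h i).2, fun i => (h i).1⟩
    simp only [T]
    rw [Finset.card_sdiff, hinter, Fintype.card_piFinset, Fintype.card_piFinset]
    simp only [hIc, hJc]
  have key : ∀ c ∈ C, (∀ x ∈ T, c x = 0) → c = 0 := by
    intro c hc hT
    have hline : ∀ i (a : ∀ i, ZMod (ni i)),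
        (∀ s ∈ I i, c (Function.update a i s) = 0) → c a = 0 := by
      intro i a h
      by_contra hne
      have h1 := hloc i c hc a ⟨a, fun _ _ => rfl, hne⟩
      have h2 : Set.ncard {x : ∀ i, ZMod (ni i) | (∀ l, l ≠ i → x l = a l) ∧ c x ≠ 0}
          ≤ Set.ncard (((I i)ᶜ : Finset (ZMod (ni i))) : Set (ZMod (ni i))) := by
        apply Set.ncard_le_ncard_of_injOn (fun x => x i)
        · rintro x ⟨hx1, hx2⟩
          simp only [Finset.coe_compl, Set.mem_compl_iff, Finset.mem_coe]
          intro hxi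
          apply hx2
          have : x = Function.update a i (x i) := by
            ext l
            by_cases hl : l = i
            · subst hl; simp
            · rw [Function.update_of_ne hl]; exact hx1 l hl
          rw [this]
          exact h _ hxi
        · rintro x ⟨hx1, -⟩ y ⟨hy1, -⟩ hxy
          funext l
          by_cases hl : l = i
          · subst hl; exact hxy
          · rw [hx1 l hl, hy1 l hl]
      rw [Set.ncard_coe_finset, Finset.card_compl, ZMod.card, hIc] at h2
      have := hb1 i
      have := hb2 i
      omega
    by_contra hc0
    have h1 := hd c hc hc0
    have h2 : Set.ncard {x : ∀ i, ZMod (ni i) | c x ≠ 0}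
        ≤ Set.ncard ((Fintype.piFinset B : Finset _) : Set (∀ i, ZMod (ni i))) := by
      apply Set.ncard_le_ncard _ (Finset.finite_toSet _)
      intro x hx
      by_contra hxB
      apply hx
      have hxB' : ∃ i, x i ∉ B i := by
        simpa [Fintype.mem_piFinset] using hxB
      obtain ⟨i, hi⟩ := hxB'
      apply box_aux I (fun x => c x = 0) hline (Finset.univ.erase i) x
      intro y hy1 hy2
      have hyi : y i = x i := hy2 i (by simp)
      apply hT
      simp only [T, Finset.mem_sdiff, Fintype.mem_piFinset]
      refine ⟨fun j => ?_, fun h => hi (hyi ▸ h i)⟩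
      by_cases hj : j = i
      · subst hj
        rw [hyi]
        simp [I, hi]
      · exact hy1 j (by simp [hj])
    rw [Set.ncard_coe_finset, Fintype.card_piFinset] at h2
    simp only [hBc] at h2
    omega
  let f : C →ₗ[F] (T → F) :=
    (LinearMap.funLeft F F (fun x : T => (x : ∀ i, ZMod (ni i)))).comp C.subtype
  have hf : Function.Injective f := by
    rw [injective_iff_map_eq_zero]
    intro c hc
    apply Subtype.ext
    apply key c.1 c.2
    intro x hx
    exact congrFun hc ⟨x, hx⟩
  have := LinearMap.finrank_le_finrank_of_injective hf
  rw [Module.finrank_fintype_fun_eq_card, Fintype.card_coe, hTc] at this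
  exact this

/-- Bound on the dimension of codes with strong availability: suppose `C` has
line-distance `ρ` in every direction, `2 ≤ ρ ≤ nᵢ`, the `nᵢ` are pairwise coprime and
sorted increasingly, `C ≠ 0` has minimum distance `d`, and
`V ξ = ⌊((d - 1) / ∏_{i < ξ} nᵢ)^(1/(t - ξ))⌋`. If `ξ < t` is the smallest index with
`n_{ξ+1} > V ξ` (0-indexed: `ni ξ > V ξ`), `v = V ξ`, and `v ≥ ρ + 1`, then
`dim_F C ≤ ∏ i (nᵢ - ρ + 1) - (v - ρ - 1)^(t - ξ) · ∏_{i < ξ} (nᵢ - ρ + 1)`. -/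
theorem dim_bound_strong_availability (F : Type*) [Field F]
    (t : ℕ) (ht : 1 ≤ t)
    (ni : Fin t → ℕ) (hni : ∀ i, 2 ≤ ni i)
    (hcop : ∀ i j : Fin t, i ≠ j → Nat.Coprime (ni i) (ni j))
    (hmono : Monotone ni)
    (C : Submodule F ((∀ i, ZMod (ni i)) → F))
    (ρ : ℕ) (hρ2 : 2 ≤ ρ) (hρn : ∀ i, ρ ≤ ni i)
    (hloc : ∀ i, HasLineDist F ni C i ρ)
    (hC : C ≠ ⊥)
    (d : ℕ)
    (hd : IsLeast {w : ℕ | ∃ c ∈ C, c ≠ 0 ∧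
      Set.ncard {x : ∀ i, ZMod (ni i) | c x ≠ 0} = w} d)
    (V : ℕ → ℕ)
    (hV : ∀ ξ : ℕ, V ξ =
      ⌊(((d : ℝ) - 1) /
          ∏ i ∈ Finset.univ.filter (fun i : Fin t => (i : ℕ) < ξ), (ni i : ℝ)) ^
        ((1 : ℝ) / ((t : ℝ) - (ξ : ℝ)))⌋₊)
    (ξ : ℕ) (hξt : ξ < t)
    (hξ : V ξ < ni ⟨ξ, hξt⟩)
    (hξmin : ∀ ξ' (h : ξ' < ξ), ¬ (V ξ' < ni ⟨ξ', h.trans hξt⟩))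
    (v : ℕ) (hv : v = V ξ) (hvρ : ρ + 1 ≤ v) :
    Module.finrank F C ≤
      (∏ i, (ni i - ρ + 1)) -
        (v - ρ - 1) ^ (t - ξ) *
          ∏ i ∈ Finset.univ.filter (fun i : Fin t => (i : ℕ) < ξ), (ni i - ρ + 1) := by
  have hd0 : 0 < d := by
    obtain ⟨c, -, hc0, hw⟩ := hd.1
    have : ∀ i, NeZero (ni i) := fun i => ⟨by have := hni i; omega⟩
    rw [← hw, Set.ncard_pos (Set.toFinite _)]
    by_contra h
    rw [Set.not_nonempty_iff_eq_empty] at h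
    apply hc0
    funext x
    by_contra hx
    have : x ∈ {x : ∀ i, ZMod (ni i) | c x ≠ 0} := hx
    rw [h] at this
    exact this
  have hcard : (Finset.univ.filter (fun i : Fin t => ¬ (i : ℕ) < ξ)).card = t - ξ := by
    have h1 := Finset.card_filter_add_card_filter_not
      (s := (Finset.univ : Finset (Fin t))) (fun i : Fin t => (i : ℕ) < ξ)
    have h2 : (Finset.univ.filter (fun i : Fin t => (i : ℕ) < ξ)).card = ξ := by
      rw [Fin.card_filter_val_lt]; omega
    rw [h2, Finset.card_univ, Fintype.card_fin] at h1
    omega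
  let b : Fin t → ℕ := fun i => if (i : ℕ) < ξ then ni i else v
  have hsplit : ∀ g : ℕ → ℕ, ∏ i, g (b i) =
      (∏ i ∈ Finset.univ.filter (fun i : Fin t => (i : ℕ) < ξ), g (ni i)) * g v ^ (t - ξ) := by
    intro g
    simp only [b, apply_ite g]
    rw [Finset.prod_ite, Finset.prod_const, hcard]
  have hb3 : ∏ i, b i < d := by
    have h1 := hsplit id
    simp only [id] at h1
    rw [h1]
    have hP : (0 : ℝ) < ∏ i ∈ Finset.univ.filter (fun i : Fin t => (i : ℕ) < ξ), (ni i : ℝ) :=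
      Finset.prod_pos fun i _ => by have := hni i; positivity
    have hd1 : (1 : ℝ) ≤ d := by exact_mod_cast hd0
    have hx : (0 : ℝ) ≤ ((d : ℝ) - 1) /
        ∏ i ∈ Finset.univ.filter (fun i : Fin t => (i : ℕ) < ξ), (ni i : ℝ) :=
      div_nonneg (by linarith) hP.le
    have hvle : (v : ℝ) ≤ (((d : ℝ) - 1) /
          ∏ i ∈ Finset.univ.filter (fun i : Fin t => (i : ℕ) < ξ), (ni i : ℝ)) ^
        ((1 : ℝ) / ((t : ℝ) - (ξ : ℝ))) := by
      rw [hv, hV ξ]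
      exact Nat.floor_le (Real.rpow_nonneg hx _)
    have hpow := pow_le_pow_left₀ (Nat.cast_nonneg v) hvle (t - ξ)
    have hts : (t : ℝ) - ξ = ((t - ξ : ℕ) : ℝ) := by rw [Nat.cast_sub hξt.le]
    rw [hts, one_div, Real.rpow_inv_natCast_pow hx (by omega), le_div_iff₀ hP] at hpow
    have : (((∏ i ∈ Finset.univ.filter (fun i : Fin t => (i : ℕ) < ξ), ni i) * v ^ (t - ξ)
        : ℕ) : ℝ) < d := by
      push_cast
      linarith
    exact_mod_cast this
  have hmain := dim_aux F t ni hni C ρ hρ2 hloc d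
    (fun c hc hc0 => hd.2 ⟨c, hc, hc0, rfl⟩) b
    (fun i => by
      simp only [b]
      split_ifs
      · exact hρn i
      · omega)
    (fun i => by
      simp only [b]
      split_ifs with h
      · exact le_rfl
      · have : ni ⟨ξ, hξt⟩ ≤ ni i := hmono (by rw [Fin.le_def]; simpa using h)
        omega) hb3
  refine hmain.trans (Nat.sub_le_sub_left ?_ _)
  rw [hsplit (fun n => n - ρ + 1), mul_comm]
  exact Nat.mul_le_mul_left _ (Nat.pow_le_pow_left (by omega) _)
end

section
/- Hyperrectangle puncturing lemma: Let C have line-distance ρ in every direction i, with 2 ≤ ρ. Let v_1, …, v_t be integers with 0 ≤ v_i ≤ n_i and let S = {x ∈ X : (x_i).val < v_i for all i} be the corresponding hyperrectangle of positions. Then the F-dimension of the subspace {c ∈ C : c x = 0 for all x ∉ S} is at most ∏_{i=1}^t max(v_i − ρ + 1, 0). -/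
/-- The subspace of functions `X → F` vanishing outside a set `S ⊆ X`. -/
def vanishingOutside (F : Type*) [Field F] {X : Type*} (S : Set X) :
    Submodule F (X → F) where
  carrier := {c | ∀ x ∉ S, c x = 0}
  add_mem' := by
    intro a b ha hb x hx
    simp [ha x hx, hb x hx]
  zero_mem' := by intro x hx; rfl
  smul_mem' := by
    intro r a ha x hx
    simp [ha x hx]

/-- Hyperrectangle puncturing lemma: if `C` has line-distance `ρ ≥ 2` in every
direction, and `S = {x | (x i).val < vᵢ for all i}` is a hyperrectangle with
`0 ≤ vᵢ ≤ nᵢ`, then the subspace of codewords of `C` supported inside `S` has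
`F`-dimension at most `∏ i, max (vᵢ - ρ + 1) 0` (written `∏ i, (vᵢ + 1 - ρ)` in
truncated natural subtraction). -/
theorem hyperrectangle_puncturing (F : Type*) [Field F]
    (t : ℕ) (ht : 1 ≤ t)
    (ni : Fin t → ℕ) (hni : ∀ i, 2 ≤ ni i)
    (C : Submodule F ((∀ i, ZMod (ni i)) → F))
    (ρ : ℕ) (hρ2 : 2 ≤ ρ)
    (hloc : ∀ i, HasLineDist F ni C i ρ)
    (v : Fin t → ℕ) (hv : ∀ i, v i ≤ ni i) :
    Module.finrank F
        ↥(C ⊓ vanishingOutside F {x : ∀ i, ZMod (ni i) | ∀ i, (x i).val < v i}) ≤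
      ∏ i, (v i + 1 - ρ) := by
  have : ∀ i, NeZero (ni i) := fun i => ⟨by have := hni i; omega⟩
  have key : ∀ c ∈ C, (∀ x, c x ≠ 0 → ∀ i, (x i).val < v i) → ∀ x, c x ≠ 0 →
      ∀ s : Finset (Fin t), ∃ y, c y ≠ 0 ∧ ∀ i ∈ s, (y i).val < v i + 1 - ρ := by
    intro c hc hS x hx s
    induction s using Finset.induction_on with
    | empty => exact ⟨x, hx, by simp⟩
    | insert i s his ih =>
      obtain ⟨y, hy, hys⟩ := ih
      by_contra! hcon
      have h1 := hloc i c hc y ⟨y, fun _ _ => rfl, hy⟩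
      have h2 : Set.ncard {x : ∀ i, ZMod (ni i) | (∀ l, l ≠ i → x l = y l) ∧ c x ≠ 0} ≤
          Set.ncard (Set.Ico (v i + 1 - ρ) (v i)) := by
        apply Set.ncard_le_ncard_of_injOn (fun x => (x i).val)
        · rintro z ⟨hz, hcz⟩
          refine ⟨?_, hS z hcz i⟩
          obtain ⟨j, hj, hjv⟩ := hcon z hcz
          rcases Finset.mem_insert.1 hj with rfl | hj'
          · exact hjv
          · have hji : j ≠ i := fun h => his (h ▸ hj')
            rw [hz j hji] at hjv
            exact absurd (hys j hj') (not_lt.2 hjv)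
        · rintro z ⟨hz, _⟩ w ⟨hw, _⟩ hzw
          funext l
          by_cases hl : l = i
          · subst hl; exact ZMod.val_injective _ hzw
          · rw [hz l hl, hw l hl]
      rw [← Finset.coe_Ico, Set.ncard_coe_finset, Nat.card_Ico] at h2
      have h3 := hS y hy i
      omega
  let e : (∀ i, Fin (v i + 1 - ρ)) → ∀ i, ZMod (ni i) := fun y i => ((y i : ℕ) : ZMod (ni i))
  let L := (LinearMap.funLeft F F e).comp
    (C ⊓ vanishingOutside F {x : ∀ i, ZMod (ni i) | ∀ i, (x i).val < v i}).subtype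
  have hL : Function.Injective L := by
    rw [injective_iff_map_eq_zero]
    rintro ⟨c, hc, hcS⟩ h0
    ext x
    by_contra hx
    have hS : ∀ x, c x ≠ 0 → ∀ i, (x i).val < v i := by
      intro z hz
      by_contra hzS
      exact hz (hcS z hzS)
    obtain ⟨y, hy, hyT⟩ := key c hc hS x hx Finset.univ
    apply hy
    have := congrFun h0 (fun i => ⟨(y i).val, hyT i (Finset.mem_univ i)⟩)
    have he : e (fun i => ⟨(y i).val, hyT i (Finset.mem_univ i)⟩) = y := by
      funext i; simp [e]
    change c (e _) = 0 at this
    rwa [he] at this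
  have := LinearMap.finrank_le_finrank_of_injective hL
  simpa [Module.finrank_fintype_fun_eq_card, Fintype.card_pi] using this
end

section
/- Dimension bound from line locality: Let C have line-distance ρ in every direction i, with 2 ≤ ρ ≤ min_i n_i. Then dim_F C ≤ ∏_{i=1}^t (n_i − ρ + 1). -/
/-- Dimension bound from line locality: if `C` has line-distance `ρ` in every
direction, with `2 ≤ ρ ≤ nᵢ` for all `i`, then `dim_F C ≤ ∏ i, (nᵢ - ρ + 1)`. -/
theorem dim_bound_from_line_locality (F : Type*) [Field F]
    (t : ℕ) (ht : 1 ≤ t)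
    (ni : Fin t → ℕ) (hni : ∀ i, 2 ≤ ni i)
    (C : Submodule F ((∀ i, ZMod (ni i)) → F))
    (ρ : ℕ) (hρ2 : 2 ≤ ρ) (hρn : ∀ i, ρ ≤ ni i)
    (hloc : ∀ i, HasLineDist F ni C i ρ) :
    Module.finrank F C ≤ ∏ i, (ni i - ρ + 1) := by
  classical
  haveI hne : ∀ i, NeZero (ni i) := fun i => ⟨by have := hni i; omega⟩
  have hA : ∀ i, ∃ A : Finset (ZMod (ni i)), A.card = ni i - ρ + 1 := by
    intro i
    have h1 : ni i - ρ + 1 ≤ (Finset.univ : Finset (ZMod (ni i))).card := by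
      rw [Finset.card_univ, ZMod.card]
      have := hρn i
      omega
    obtain ⟨A, -, h⟩ := Finset.exists_subset_card_eq h1
    exact ⟨A, h⟩
  choose A hAc using hA
  have key : ∀ c ∈ C, (∀ x, (∀ l, x l ∈ A l) → c x = 0) → c = 0 := by
    intro c hc h0
    have : ∀ S : Finset (Fin t), ∀ x : ∀ i, ZMod (ni i),
        (∀ l, l ∉ S → x l ∈ A l) → c x = 0 := by
      intro S
      induction S using Finset.induction_on with
      | empty => intro x hx; exact h0 x (fun l => hx l (by simp))
      | insert k S hk ih =>
        intro x hx
        by_contra hcx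
        have h1 := hloc k c hc x ⟨x, fun _ _ => rfl, hcx⟩
        have h2 := Set.ncard_le_ncard_of_injOn
          (s := {y : ∀ i, ZMod (ni i) | (∀ l, l ≠ k → y l = x l) ∧ c y ≠ 0})
          (t := (((A k)ᶜ : Finset (ZMod (ni k))) : Set (ZMod (ni k)))) (fun y => y k)
          (by
            rintro y ⟨hy, hcy⟩
            simp only [Finset.coe_compl, Set.mem_compl_iff, Finset.mem_coe]
            intro hyk
            apply hcy
            apply ih
            intro l hl
            by_cases hlk : l = k
            · subst hlk; exact hyk
            · rw [hy l hlk]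
              exact hx l (by simp [hlk, hl]))
          (by
            rintro y ⟨hy, -⟩ z ⟨hz, -⟩ hyz
            funext l
            by_cases hlk : l = k
            · subst hlk; exact hyz
            · rw [hy l hlk, hz l hlk])
          (Finset.finite_toSet _)
        rw [Set.ncard_coe_finset, Finset.card_compl, ZMod.card, hAc] at h2
        have := hρn k
        omega
    funext x
    exact this Finset.univ x (fun l hl => absurd (Finset.mem_univ l) hl)
  let f : C →ₗ[F] ((∀ i, A i) → F) :=
    (LinearMap.funLeft F F (fun (y : ∀ i, A i) => fun i => (y i : ZMod (ni i)))).comp C.subtype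
  have hf : Function.Injective f := by
    rw [injective_iff_map_eq_zero]
    intro c hc
    apply Subtype.ext
    apply key c.1 c.2
    intro x hx
    exact congrFun hc (fun i => ⟨x i, hx i⟩)
  have := LinearMap.finrank_le_finrank_of_injective hf
  rw [Module.finrank_fintype_fun_eq_card, Fintype.card_pi] at this
  simpa [hAc] using this
end
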